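/- (Robustness of Interp.) Let X be a real normed vector space, T a positive integer, x_0 ∈ X, and f_1, …, f_T : X → ℝ convex functions with f_t ≥ 0 everywhere. Let x̃_0 = x_0, x̃_1, …, x̃_T and s_0 = x_0, s_1, …, s_T be arbitrary sequences in X, let γ > 0 and δ > 0, set ε = 2γ + 2δ, let μ ≥ 1 be a real number that is simultaneously a rectangular bound for X and a radial Lipschitz bound for X, and let k be a radial Lipschitz bound for X with 1 ≤ k ≤ μ. Let x_0, x_1, …, x_T be the Interp sequence determined by these data. Then C_x(1, T) ≤ (1 + k/γ + (μ + ε + 1 + k/γ)/δ)·C_s(1, T). -/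

import Mathlib

/-- The radial retraction onto the closed ball of radius `r`. -/
noncomputable def radial {X : Type*} [NormedAddCommGroup X] [NormedSpace ℝ X]
    (v : X) (r : ℝ) : X :=
  if ‖v‖ ≤ r then v else (r / ‖v‖) • v

/-- `u` is Birkhoff-James orthogonal to `v`. -/
def BJOrth {X : Type*} [NormedAddCommGroup X] [NormedSpace ℝ X] (u v : X) : Prop :=
  ∀ l : ℝ, ‖u‖ ≤ ‖u + l • v‖

/-- `μ` is a rectangular bound for `X`. -/
def RectBound (X : Type*) [NormedAddCommGroup X] [NormedSpace ℝ X] (μ : ℝ) : Prop :=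
  ∀ u v : X, BJOrth u v → ‖u‖ + ‖v‖ ≤ μ * ‖u + v‖

/-- `k` is a radial Lipschitz bound for `X`. -/
def RadialLipBound (X : Type*) [NormedAddCommGroup X] [NormedSpace ℝ X] (k : ℝ) : Prop :=
  ∀ u v : X, ∀ r : ℝ, 0 < r → ‖radial u r - radial v r‖ ≤ k * ‖u - v‖

/-- The cost of the sequence `z` over times `a` through `b`:
`C_z(a, b) = Σ_{t=a}^{b} (f_t(z_t) + ‖z_t − z_{t−1}‖)`. -/
noncomputable def cost {X : Type*} [NormedAddCommGroup X]
    (f : ℕ → X → ℝ) (z : ℕ → X) (a b : ℕ) : ℝ :=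
  ∑ t ∈ Finset.Icc a b, (f t (z t) + ‖z t - z (t - 1)‖)

section Radial

variable {X : Type*} [NormedAddCommGroup X] [NormedSpace ℝ X]

theorem radial_of_le {v : X} {r : ℝ} (h : ‖v‖ ≤ r) : radial v r = v := if_pos h

theorem radial_of_ge {v : X} {r : ℝ} (h : r ≤ ‖v‖) :
    radial v r = (r / ‖v‖) • v := by
  unfold radial
  split_ifs with h'
  · rcases eq_or_ne v 0 with rfl | hv
    · simp
    · rw [le_antisymm h h', div_self (norm_ne_zero_iff.2 hv), one_smul]
  · rfl

theorem radial_zero (v : X) : radial v 0 = 0 := by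
  rw [radial_of_ge (norm_nonneg v)]; simp

theorem exists_radial_eq_smul (v : X) {r : ℝ} (hr : 0 ≤ r) :
    ∃ c : ℝ, 0 ≤ c ∧ c ≤ 1 ∧ radial v r = c • v := by
  rcases le_total ‖v‖ r with h | h
  · exact ⟨1, zero_le_one, le_rfl, by rw [radial_of_le h, one_smul]⟩
  · exact ⟨r / ‖v‖, by positivity, div_le_one_of_le₀ h (norm_nonneg v), radial_of_ge h⟩

theorem norm_radial (v : X) {r : ℝ} (hr : 0 ≤ r) : ‖radial v r‖ = min ‖v‖ r := by
  rcases le_total ‖v‖ r with h | h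
  · rw [radial_of_le h, min_eq_left h]
  · rw [radial_of_ge h, min_eq_right h, norm_smul, Real.norm_eq_abs, abs_of_nonneg (by positivity)]
    rcases (norm_nonneg v).eq_or_lt' with h0 | h0
    · rw [h0] at h ⊢; simp [le_antisymm h hr]
    · field_simp

theorem norm_sub_radial (v : X) {r : ℝ} (hr : 0 ≤ r) :
    ‖v - radial v r‖ = ‖v‖ - min ‖v‖ r := by
  obtain ⟨c, hc0, hc1, hc⟩ := exists_radial_eq_smul v hr
  have h := norm_radial v hr
  rw [hc, norm_smul, Real.norm_eq_abs, abs_of_nonneg hc0] at h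
  rw [hc, ← h, show v - c • v = (1 - c) • v by module, norm_smul, Real.norm_eq_abs,
    abs_of_nonneg (by linarith)]
  ring

theorem radial_radial (v : X) {r q : ℝ} (hq : 0 ≤ q) (hqr : q ≤ r) :
    radial (radial v r) q = radial v q := by
  rcases le_total ‖v‖ r with h | h
  · rw [radial_of_le h]
  · have hr := hq.trans hqr
    have hn : ‖radial v r‖ = r := by rw [norm_radial v hr, min_eq_right h]
    rw [radial_of_ge (hqr.trans hn.ge), hn, radial_of_ge h, radial_of_ge (hqr.trans h),
      smul_smul]
    rcases hr.eq_or_lt' with h0 | h0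
    · have : q = 0 := by linarith
      simp [this]
    · congr 1; field_simp

theorem radial_norm_radial (v : X) {r : ℝ} (hr : 0 ≤ r) :
    radial v ‖radial v r‖ = radial v r := by
  rw [norm_radial v hr]
  rcases le_total ‖v‖ r with h | h
  · rw [min_eq_left h, radial_of_le le_rfl, radial_of_le h]
  · rw [min_eq_right h]

theorem norm_sub_radial_sub_le_of_norm_le {v w : X} {r : ℝ} (hr : 0 ≤ r) (h : ‖w‖ ≤ ‖v‖) :
    ‖(v - radial v r) - (w - radial w r)‖ ≤ ‖v - w‖ := by
  rcases le_total ‖w‖ r with hw | hw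
  · rw [radial_of_le hw, sub_self, sub_zero, norm_sub_radial v hr]
    rcases le_total ‖v‖ r with hv | hv
    · rw [min_eq_left hv, sub_self]; positivity
    · rw [min_eq_right hv]; linarith [norm_sub_norm_le v w]
  · have hv := hw.trans h
    rw [radial_of_ge hw, radial_of_ge hv]
    rcases (norm_nonneg w).eq_or_lt' with h0 | h0
    · have : r = 0 := by linarith
      simp [this]
    have hv0 : 0 < ‖v‖ := h0.trans_le h
    have hr1 : r / ‖v‖ ≤ 1 := div_le_one_of_le₀ hv hv0.le
    have hd : 0 ≤ r / ‖w‖ - r / ‖v‖ := sub_nonneg.2 (by gcongr)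
    calc ‖(v - (r / ‖v‖) • v) - (w - (r / ‖w‖) • w)‖
        = ‖(1 - r / ‖v‖) • (v - w) + (r / ‖w‖ - r / ‖v‖) • w‖ := by congr 1; module
      _ ≤ (1 - r / ‖v‖) * ‖v - w‖ + (r / ‖w‖ - r / ‖v‖) * ‖w‖ := by
          refine (norm_add_le _ _).trans ?_
          rw [norm_smul, norm_smul, Real.norm_of_nonneg (by linarith), Real.norm_of_nonneg hd]
      _ = (1 - r / ‖v‖) * ‖v - w‖ + (r / ‖v‖) * (‖v‖ - ‖w‖) := by field_simp
      _ ≤ (1 - r / ‖v‖) * ‖v - w‖ + (r / ‖v‖) * ‖v - w‖ := by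
          gcongr; exact norm_sub_norm_le v w
      _ = ‖v - w‖ := by ring

/-- The complement `v ↦ v - radial v r` of the radial retraction is nonexpansive in every
normed space. -/
theorem norm_sub_radial_sub_le (v w : X) {r : ℝ} (hr : 0 ≤ r) :
    ‖(v - radial v r) - (w - radial w r)‖ ≤ ‖v - w‖ := by
  rcases le_total ‖w‖ ‖v‖ with h | h
  · exact norm_sub_radial_sub_le_of_norm_le hr h
  · rw [norm_sub_rev, norm_sub_rev v w]
    exact norm_sub_radial_sub_le_of_norm_le hr h

theorem RadialLipBound.of_nonneg {k : ℝ} (hk : 0 ≤ k) (h : RadialLipBound X k) (u v : X) {r : ℝ}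
    (hr : 0 ≤ r) : ‖radial u r - radial v r‖ ≤ k * ‖u - v‖ := by
  rcases hr.eq_or_lt with rfl | hr
  · simp only [radial_zero, sub_self, norm_zero]; positivity
  · exact h u v r hr

theorem ConvexOn.map_add_radial_le {f : X → ℝ} (hf : ConvexOn ℝ Set.univ f) (h0 : ∀ p, 0 ≤ f p)
    (s a : X) {r : ℝ} (hr : 0 ≤ r) : f (s + radial (a - s) r) ≤ f s + f a := by
  obtain ⟨c, hc0, hc1, hc⟩ := exists_radial_eq_smul (a - s) hr
  have h := hf.2 (Set.mem_univ s) (Set.mem_univ a) (sub_nonneg.2 hc1) hc0 (by ring)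
  rw [hc, show s + c • (a - s) = (1 - c) • s + c • a by module]
  simp only [smul_eq_mul] at h
  nlinarith [h0 s, h0 a]

/-- Mean value property of the norm along a segment: at some interior point, the slope of the
chord is a subgradient. -/
theorem exists_norm_add_smul_ge (a u : X) :
    ∃ θ : ℝ, 0 < θ ∧ θ < 1 ∧ ∀ η : ℝ,
      ‖a + θ • u‖ + η * (‖a + u‖ - ‖a‖) ≤ ‖(a + θ • u) + η • u‖ := by
  set c := ‖a + u‖ - ‖a‖ with hc
  set G : ℝ → ℝ := fun θ => ‖a + θ • u‖ - θ * c with hG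
  have hconv : ConvexOn ℝ Set.univ G := by
    refine ⟨convex_univ, fun p _ q _ α β hα hβ hαβ => ?_⟩
    have h1 : a + (α • p + β • q) • u = α • (a + p • u) + β • (a + q • u) := by
      obtain rfl : β = 1 - α := by linarith
      simp only [smul_eq_mul]; module
    have h2 := norm_add_le (α • (a + p • u)) (β • (a + q • u))
    rw [norm_smul, norm_smul, Real.norm_of_nonneg hα, Real.norm_of_nonneg hβ] at h2
    simp only [hG, h1]
    simp only [smul_eq_mul]
    linarith
  have hcont : Continuous G := by fun_prop
  have hG0 : G 0 = ‖a‖ := by simp [hG]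
  have hG1 : G 1 = ‖a‖ := by simp [hG, hc]
  obtain ⟨m, hm, hmin⟩ := isCompact_Icc.exists_isMinOn (Set.nonempty_Icc.2 zero_le_one)
    hcont.continuousOn (s := Set.Icc (0 : ℝ) 1)
  obtain ⟨θ, hθ, hθmin⟩ : ∃ θ ∈ Set.Ioo (0 : ℝ) 1, IsMinOn G (Set.Icc 0 1) θ := by
    by_cases hmm : m ∈ Set.Ioo (0 : ℝ) 1
    · exact ⟨m, hmm, hmin⟩
    · have hGm : G m = ‖a‖ := by
        rcases hm.1.eq_or_lt with h | h
        · rw [← h, hG0]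
        · rcases hm.2.eq_or_lt with h' | h'
          · rw [h', hG1]
          · exact absurd ⟨h, h'⟩ hmm
      refine ⟨1 / 2, by norm_num, fun q hq => ?_⟩
      have h := hconv.2 (Set.mem_univ 0) (Set.mem_univ 1)
        (show (0 : ℝ) ≤ 1 / 2 by norm_num) (show (0 : ℝ) ≤ 1 / 2 by norm_num) (by norm_num)
      have h' : G m ≤ G q := hmin hq
      simp only [smul_eq_mul, mul_zero, mul_one, zero_add, hG0, hG1] at h
      change G (1 / 2) ≤ G q
      linarith
  have hglob := IsMinOn.of_isLocalMin_of_convex_univ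
    (hθmin.isLocalMin (Icc_mem_nhds hθ.1 hθ.2)) hconv
  refine ⟨θ, hθ.1, hθ.2, fun η => ?_⟩
  have h := hglob (θ + η)
  simp only [hG] at h
  rw [show a + (θ + η) • u = a + θ • u + η • u by module] at h
  linarith

theorem bjOrth_smul_left {u v : X} (h : BJOrth u v) (c : ℝ) : BJOrth (c • u) v := by
  intro l
  rcases eq_or_ne c 0 with rfl | hc
  · simp
  · rw [show c • u + l • v = c • (u + (l / c) • v) by
      rw [smul_add, smul_smul, mul_div_cancel₀ _ hc], norm_smul, norm_smul]
    gcongr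
    exact h _

theorem bjOrth_of_subgradient {w u : X} {c : ℝ} (hw : 0 < ‖w‖) (hcu : |c| ≤ ‖u‖)
    (h : ∀ η : ℝ, ‖w‖ + η * c ≤ ‖w + η • u‖) : BJOrth w (u - (c / ‖w‖) • w) := by
  intro l
  set q := c / ‖w‖ with hq
  have hqw : q * ‖w‖ = c := by rw [hq]; field_simp
  have e : w + l • (u - q • w) = (1 - l * q) • w + l • u := by module
  rw [e]
  rcases lt_or_ge 0 (1 - l * q) with hp | hp
  · have h1 := h (l / (1 - l * q))
    have e2 : (1 - l * q) • w + l • u = (1 - l * q) • (w + (l / (1 - l * q)) • u) := by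
      rw [smul_add, smul_smul, mul_div_cancel₀ _ hp.ne']
    rw [e2, norm_smul, Real.norm_of_nonneg hp.le]
    calc ‖w‖ = (1 - l * q) * (‖w‖ + l / (1 - l * q) * c) := by
          rw [← hqw]; field_simp; ring
      _ ≤ _ := by gcongr
  · have h1 := norm_sub_le ((1 - l * q) • w + l • u) ((1 - l * q) • w)
    rw [add_sub_cancel_left, norm_smul, norm_smul, Real.norm_of_nonpos hp, Real.norm_eq_abs] at h1
    have h2 : l * c ≤ |l| * ‖u‖ := by
      calc l * c ≤ |l * c| := le_abs_self _
        _ = |l| * |c| := abs_mul _ _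
        _ ≤ _ := by gcongr
    have h3 : l * q * ‖w‖ = l * c := by rw [mul_assoc, hqw]
    linarith

theorem norm_sub_le_norm_add_smul {a p x : X} {α β τ : ℝ} (hp : ‖p‖ = 1) (hx : ‖x‖ ≤ 1)
    (hαβ : 1 ≤ α + β) (hα : 0 ≤ α) (hτ : 0 ≤ τ) (hxe : x = α • a + β • p) :
    ‖p - a‖ ≤ ‖(p - a) + τ • (p - x)‖ := by
  set m := α + β with hm
  have hm0 : 0 < m := by linarith
  have hmp : m • p = x + α • (p - a) := by rw [hxe, hm]; module
  have h1 : m ≤ 1 + α * ‖p - a‖ := by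
    have h := norm_add_le x (α • (p - a))
    rw [← hmp, norm_smul, norm_smul, hp, Real.norm_of_nonneg hm0.le, Real.norm_of_nonneg hα] at h
    linarith
  have e : m • ((p - a) + τ • (p - x)) = (m + τ * α) • (p - a) - (τ * (m - 1)) • x := by
    have : m • ((p - a) + τ • (p - x)) = m • (p - a) + τ • (m • p) - (τ * m) • x := by module
    rw [this, hmp]; module
  have h2 := norm_sub_norm_le ((m + τ * α) • (p - a)) ((τ * (m - 1)) • x)
  have hτm : 0 ≤ τ * (m - 1) := mul_nonneg hτ (by linarith)
  rw [← e, norm_smul, norm_smul, norm_smul, Real.norm_of_nonneg hm0.le,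
    Real.norm_of_nonneg (by positivity), Real.norm_of_nonneg hτm] at h2
  have h3 : τ * (m - 1) * ‖x‖ ≤ τ * (m - 1) := mul_le_of_le_one_right hτm hx
  have h4 : τ * (m - 1) ≤ τ * (α * ‖p - a‖) := by gcongr; linarith
  refine le_of_mul_le_mul_left ?_ hm0
  linarith

theorem RectBound.norm_sub_add_le_of_unit {μ : ℝ} (hμ : 1 ≤ μ) (hrect : RectBound X μ) {a p : X}
    (ha : ‖a‖ = 1) (hp : ‖p‖ = 1) {t : ℝ} (ht : 1 ≤ t) :
    ‖a - p‖ + (t - 1) ≤ μ * ‖a - t • p‖ := by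
  set u := t • p - a with hu
  have hau : a + u = t • p := by rw [hu]; abel
  have htp : ‖t • p‖ = t := by rw [norm_smul, hp, Real.norm_of_nonneg (by linarith), mul_one]
  have hcu : |t - 1| ≤ ‖u‖ := by
    have h := norm_sub_norm_le (t • p) a
    rw [htp, ha] at h
    rwa [abs_of_nonneg (by linarith)]
  have hnu : ‖a - t • p‖ = ‖u‖ := norm_sub_rev _ _
  rw [hnu]
  obtain ⟨θ, hθ0, hθ1, hθ⟩ := exists_norm_add_smul_ge a u
  rw [hau, htp, ha] at hθ
  set w := a + θ • u with hw
  have hwe : w = (1 - θ) • a + (θ * t) • p := by rw [hw, hu]; module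
  rcases (norm_nonneg w).eq_or_lt' with h0 | h0
  · have hw0 : w = 0 := norm_eq_zero.1 h0
    have h1 : (1 - θ) • a = -((θ * t) • p) := by
      rw [hwe] at hw0; exact eq_neg_of_add_eq_zero_left hw0
    have h2 : 1 - θ = θ * t := by
      have := congrArg norm h1
      rwa [norm_neg, norm_smul, norm_smul, ha, hp, mul_one, mul_one, Real.norm_of_nonneg
        (by linarith), Real.norm_of_nonneg (by positivity)] at this
    have h3 : a = -p := by
      rw [h2, ← smul_neg] at h1
      exact smul_right_injective X (show θ * t ≠ 0 by positivity) h1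
    have h4 : u = (t + 1) • p := by rw [hu, h3]; module
    have h5 : ‖u‖ = t + 1 := by
      rw [h4, norm_smul, hp, Real.norm_of_nonneg (by linarith), mul_one]
    have h6 := norm_sub_le a p
    nlinarith
  · have hb := bjOrth_smul_left (bjOrth_of_subgradient h0 hcu hθ) ((t - 1) / ‖w‖)
    have h1 := hrect _ _ hb
    rw [add_sub_cancel] at h1
    set x := (1 / ‖w‖) • w with hx
    have hxn : ‖x‖ = 1 := by
      rw [hx, norm_smul, Real.norm_of_nonneg (by positivity)]; field_simp
    have hxw : ((t - 1) / ‖w‖) • w = (t - 1) • x := by rw [hx, smul_smul]; congr 1; ring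
    have hxe : x = ((1 - θ) / ‖w‖) • a + (θ * t / ‖w‖) • p := by
      rw [hx, hwe, smul_add, smul_smul, smul_smul, ← hwe]; congr 2 <;> ring
    have hα : 0 ≤ (1 - θ) / ‖w‖ := div_nonneg (by linarith) h0.le
    have hβ : 0 ≤ θ * t / ‖w‖ := by positivity
    have hαβ : 1 ≤ (1 - θ) / ‖w‖ + θ * t / ‖w‖ := by
      have h := norm_add_le (((1 - θ) / ‖w‖) • a) ((θ * t / ‖w‖) • p)
      rwa [← hxe, hxn, norm_smul, norm_smul, ha, hp, Real.norm_of_nonneg hα,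
        Real.norm_of_nonneg hβ, mul_one, mul_one] at h
    have h2 := norm_sub_le_norm_add_smul hp hxn.le hαβ hα (sub_nonneg.2 ht) hxe
    rw [hxw, norm_smul, hxn, Real.norm_of_nonneg (by linarith), mul_one,
      show u - (t - 1) • x = (p - a) + (t - 1) • (p - x) by rw [hu]; module] at h1
    rw [norm_sub_rev a p]
    linarith

theorem norm_radial_sub_add_le {μ : ℝ} (hμ : 1 ≤ μ) (hrect : RectBound X μ)
    (hlip : RadialLipBound X μ) (a b : X) {r : ℝ} (hr : 0 ≤ r) (hra : r ≤ ‖a‖) :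
    ‖radial a r - radial b r‖ + ‖radial b r - b‖ ≤ ‖radial a r - a‖ + μ * ‖a - b‖ := by
  have hab : 0 ≤ ‖a - b‖ := norm_nonneg _
  rcases le_total ‖b‖ r with hb | hb
  · rw [radial_of_le hb, sub_self, norm_zero, add_zero]
    have := norm_sub_le_norm_sub_add_norm_sub (radial a r) a b
    nlinarith
  · rw [norm_sub_rev _ b, norm_sub_rev _ a, norm_sub_radial b hr, norm_sub_radial a hr,
      min_eq_right hb, min_eq_right hra]
    have hl := hlip.of_nonneg (by linarith) a b hr
    rcases le_total ‖b‖ ‖a‖ with h | h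
    · linarith
    rcases hr.eq_or_lt' with rfl | hr0
    · simp only [radial_zero, sub_self, norm_zero]
      have := norm_sub_norm_le b a
      rw [norm_sub_rev] at this
      nlinarith
    have ha0 : 0 < ‖a‖ := hr0.trans_le hra
    have hb0 : 0 < ‖b‖ := hr0.trans_le hb
    set a1 := (1 / ‖a‖) • a with ha1
    set b1 := (1 / ‖b‖) • b with hb1
    have na1 : ‖a1‖ = 1 := by
      rw [ha1, norm_smul, Real.norm_of_nonneg (by positivity)]; field_simp
    have nb1 : ‖b1‖ = 1 := by
      rw [hb1, norm_smul, Real.norm_of_nonneg (by positivity)]; field_simp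
    have hu := hrect.norm_sub_add_le_of_unit hμ na1 nb1 ((one_le_div ha0).2 h)
    have e1 : a1 - (‖b‖ / ‖a‖) • b1 = (1 / ‖a‖) • (a - b) := by
      rw [ha1, hb1, smul_smul, smul_sub]; congr 2; field_simp
    have e2 : radial a r - radial b r = r • (a1 - b1) := by
      rw [radial_of_ge hra, radial_of_ge hb, ha1, hb1, smul_sub, smul_smul, smul_smul]
      congr 2 <;> ring
    rw [e1, norm_smul, Real.norm_of_nonneg (by positivity)] at hu
    rw [e2, norm_smul, Real.norm_of_nonneg hr]
    have h5 : ‖a‖ * (‖a1 - b1‖ + (‖b‖ / ‖a‖ - 1)) ≤ ‖a‖ * (μ * (1 / ‖a‖ * ‖a - b‖)) := by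
      gcongr
    have e3 : ‖a‖ * (‖a1 - b1‖ + (‖b‖ / ‖a‖ - 1)) = ‖a‖ * ‖a1 - b1‖ + (‖b‖ - ‖a‖) := by
      field_simp
    have e4 : ‖a‖ * (μ * (1 / ‖a‖ * ‖a - b‖)) = μ * ‖a - b‖ := by field_simp
    have h6 : r * ‖a1 - b1‖ ≤ ‖a‖ * ‖a1 - b1‖ := by gcongr
    linarith

end Radial

section Interp

variable {X : Type*} [NormedAddCommGroup X] [NormedSpace ℝ X]

/-- One step of Interp that does not jump to the advice, from `x` to `x'`, while the robust
sequence moves from `s` to `s'` and the advice from `a` to `a'`; `G` is the decrease `γ * Δ` of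
the radius. -/
theorem interp_robust_step {μ k : ℝ} (hμ : 1 ≤ μ) (hrect : RectBound X μ)
    (hlip : RadialLipBound X μ) (hk : 1 ≤ k) (hklip : RadialLipBound X k)
    {a a' s s' x x' y z : X} {G : ℝ} (hG : 0 ≤ G)
    (hx : x = s + radial (a - s) ‖x - s‖)
    (hy : y = s + radial (a' - s) ‖x - s‖)
    (hz : z = s + radial (y - s) (max (‖y - s‖ - G) 0))
    (hx' : x' = s' + radial (a' - s') ‖z - s‖) :
    x' = s' + radial (a' - s') ‖x' - s'‖ ∧
    ‖x' - x‖ + ‖x' - a'‖ ≤ ‖x - a‖ + μ * ‖a' - a‖ + 2 * G + 2 * ‖s' - s‖ ∧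
    (x' = s' ∨ (‖x' - x‖ ≤ k * ‖a' - a‖ + G + ‖s' - s‖ ∧ ‖x' - s'‖ + G ≤ ‖x - s‖)) := by
  set R := ‖x - s‖ with hR
  have hR0 : 0 ≤ R := norm_nonneg _
  set q := max (‖y - s‖ - G) 0 with hq
  have hq0 : 0 ≤ q := le_max_right _ _
  have hys : y - s = radial (a' - s) R := by rw [hy]; abel
  have hyn : ‖y - s‖ = min ‖a' - s‖ R := by rw [hys, norm_radial _ hR0]
  have hqy : q ≤ ‖y - s‖ := max_le (by linarith) (norm_nonneg _)
  have hqR : q ≤ R := hqy.trans (hyn.le.trans (min_le_right _ _))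
  have hzs : z - s = radial (y - s) q := by rw [hz]; abel
  have hzn : ‖z - s‖ = q := by rw [hzs, norm_radial _ hq0, min_eq_right hqy]
  have hzr : z - s = radial (a' - s) q := by rw [hzs, hys, radial_radial _ hq0 hqR]
  rw [hzn] at hx'
  have hxs' : x' - s' = radial (a' - s') q := by rw [hx']; abel
  have hxs : x - s = radial (a - s) R := by
    nth_rewrite 1 [hx]; abel
  have hRa : R ≤ ‖a - s‖ := by
    have h := norm_radial (a - s) hR0
    rw [← hxs, ← hR] at h
    rw [h]; exact min_le_left _ _
  have hyz : ‖z - y‖ ≤ G := by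
    rw [norm_sub_rev, show y - z = (y - s) - radial (y - s) q by rw [← hzs]; abel,
      norm_sub_radial _ hq0, min_eq_right hqy]
    linarith [le_max_left (‖y - s‖ - G) 0]
  have hxz : ‖x' - z‖ ≤ ‖s' - s‖ := by
    have h := norm_sub_radial_sub_le (a' - s) (a' - s') hq0
    rwa [← hzr, ← hxs', show a' - s - (z - s) - (a' - s' - (x' - s')) = x' - z by abel,
      show a' - s - (a' - s') = s' - s by abel] at h
  have hxy : ‖x - y‖ ≤ k * ‖a' - a‖ := by
    have h := hklip.of_nonneg (by linarith) (a - s) (a' - s) hR0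
    rwa [← hys, ← hxs, sub_sub_sub_cancel_right, sub_sub_sub_cancel_right, norm_sub_rev a] at h
  have hgeo : ‖x - y‖ + ‖y - a'‖ ≤ ‖x - a‖ + μ * ‖a' - a‖ := by
    have h := norm_radial_sub_add_le hμ hrect hlip (a - s) (a' - s) hR0 hRa
    rwa [← hys, ← hxs, sub_sub_sub_cancel_right, sub_sub_sub_cancel_right,
      sub_sub_sub_cancel_right, sub_sub_sub_cancel_right, norm_sub_rev a] at h
  have hmove : ‖x' - x‖ ≤ ‖s' - s‖ + G + ‖x - y‖ := by
    have h1 := norm_sub_le_norm_sub_add_norm_sub x' z x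
    have h2 := norm_sub_le_norm_sub_add_norm_sub z y x
    rw [norm_sub_rev y x] at h2
    linarith
  refine ⟨?_, ?_, ?_⟩
  · rw [hxs', radial_norm_radial _ hq0]; exact hx'
  · have h1 := norm_sub_le_norm_sub_add_norm_sub x' z a'
    have h2 := norm_sub_le_norm_sub_add_norm_sub z y a'
    linarith
  · rcases le_total (‖y - s‖ - G) 0 with h | h
    · left
      have : q = 0 := max_eq_right h
      rw [hx', this, radial_zero, add_zero]
    · right
      have h1 : q = ‖y - s‖ - G := max_eq_left h
      have h2 : ‖x' - s'‖ ≤ q := by rw [hxs', norm_radial _ hq0]; exact min_le_right _ _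
      have h3 : ‖y - s‖ ≤ R := hyn.le.trans (min_le_right _ _)
      exact ⟨by linarith, by linarith⟩

end Interp

theorem cost_zero {X : Type*} [NormedAddCommGroup X] (f : ℕ → X → ℝ) (z : ℕ → X) : cost f z 1 0 = 0 := by
  simp [cost]

theorem cost_succ {X : Type*} [NormedAddCommGroup X] (f : ℕ → X → ℝ) (z : ℕ → X) (n : ℕ) :
    cost f z 1 (n + 1) = cost f z 1 n + (f (n + 1) (z (n + 1)) + ‖z (n + 1) - z n‖) := by
  simp [cost, Finset.sum_Icc_succ_top]

theorem norm_sub_zero_le_cost {X : Type*} [NormedAddCommGroup X] {T : ℕ} {f : ℕ → X → ℝ}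
    (hnn : ∀ t ∈ Finset.Icc 1 T, ∀ p : X, 0 ≤ f t p) (z : ℕ → X) :
    ∀ n ≤ T, ‖z n - z 0‖ ≤ cost f z 1 n := by
  intro n
  induction n with
  | zero => simp [cost_zero]
  | succ n ih =>
    intro hn
    have h1 := ih (by omega)
    have h2 := hnn (n + 1) (Finset.mem_Icc.2 ⟨by omega, hn⟩) (z (n + 1))
    have h3 := norm_sub_le_norm_sub_add_norm_sub (z (n + 1)) (z n) (z 0)
    rw [cost_succ]
    linarith

/-- **Robustness of Interp.** Given convex nonnegative hitting costs
`f_1, …, f_T`, an advice sequence `adv`, a robust sequence `s` (both starting at `x₀`),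
parameters `γ, δ > 0` with `ε = 2γ + 2δ`, `μ ≥ 1` a simultaneous rectangular and radial
Lipschitz bound for `X`, and `k` a radial Lipschitz bound with `1 ≤ k ≤ μ`, the Interp
sequence `x` satisfies `C_x(1, T) ≤ (1 + k/γ + (μ + ε + 1 + k/γ)/δ)·C_s(1, T)`. -/
theorem interp_robustness
    {X : Type*} [NormedAddCommGroup X] [NormedSpace ℝ X]
    (T : ℕ) (hT : 1 ≤ T) (x₀ : X) (f : ℕ → X → ℝ)
    (hconv : ∀ t ∈ Finset.Icc 1 T, ConvexOn ℝ Set.univ (f t))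
    (hnn : ∀ t ∈ Finset.Icc 1 T, ∀ p : X, 0 ≤ f t p)
    (adv s x : ℕ → X)
    (hadv0 : adv 0 = x₀) (hs0 : s 0 = x₀) (hx0 : x 0 = x₀)
    (γ δ ε μ : ℝ) (hγ : 0 < γ) (hδ : 0 < δ) (hε : ε = 2 * γ + 2 * δ)
    (hμ1 : 1 ≤ μ) (hrect : RectBound X μ) (hlip : RadialLipBound X μ)
    (k : ℝ) (hk1 : 1 ≤ k) (hkμ : k ≤ μ) (hklip : RadialLipBound X k)
    (hstep : ∀ t ∈ Finset.Icc 1 T,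
      x t =
        if δ * cost f adv 1 t ≤ cost f s 1 t then adv t
        else
          let Δ := f t (adv t) + ‖adv t - adv (t - 1)‖
          let y := s (t - 1) + radial (adv t - s (t - 1)) ‖x (t - 1) - s (t - 1)‖
          let z := s (t - 1) +
            radial (y - s (t - 1)) (max (‖y - s (t - 1)‖ - γ * Δ) 0)
          s t + radial (adv t - s t) ‖z - s (t - 1)‖) :
    cost f x 1 T ≤ (1 + k / γ + (μ + ε + 1 + k / γ) / δ) * cost f s 1 T := by
  set K := 1 + k / γ + (μ + ε + 1 + k / γ) / δ with hK
  have hkγ : 0 ≤ k / γ := by positivity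
  have hε0 : 0 ≤ ε := by rw [hε]; positivity
  have hK1 : 1 ≤ K := by
    have : 0 ≤ (μ + ε + 1 + k / γ) / δ := by positivity
    linarith
  have key : ∀ n ≤ T,
      x n = s n + radial (adv n - s n) ‖x n - s n‖ ∧
      cost f x 1 n + ‖x n - adv n‖ ≤ (μ + 2 * γ) * cost f adv 1 n + 2 * cost f s 1 n ∧
      cost f x 1 n + ‖x n - adv n‖ ≤ (μ + ε) * cost f adv 1 n ∧
      cost f x 1 n + (1 + k / γ) * ‖x n - s n‖ ≤ K * cost f s 1 n := by
    intro n
    induction n with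
    | zero => simp [cost_zero, hadv0, hs0, hx0, radial_of_le]
    | succ n ih =>
      intro hn
      obtain ⟨ihx, ih1, ih2, ih3⟩ := ih (by omega)
      have hmem : n + 1 ∈ Finset.Icc 1 T := Finset.mem_Icc.2 ⟨by omega, hn⟩
      have hst := hstep (n + 1) hmem
      have hf := hnn (n + 1) hmem
      have hfa := hf (adv (n + 1))
      have hfs := hf (s (n + 1))
      have hda : 0 ≤ ‖adv (n + 1) - adv n‖ := norm_nonneg _
      have hds : 0 ≤ ‖s (n + 1) - s n‖ := norm_nonneg _
      have hAn := norm_sub_zero_le_cost hnn adv (n + 1) hn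
      have hSn := norm_sub_zero_le_cost hnn s (n + 1) hn
      simp only [Nat.add_sub_cancel] at hst
      split_ifs at hst with hcond
      · have hmove := norm_sub_le_norm_sub_add_norm_sub (adv (n + 1)) (adv n) (x n)
        rw [norm_sub_rev (adv n) (x n)] at hmove
        have hA : cost f adv 1 (n + 1) ≤ cost f s 1 (n + 1) / δ := by
          rw [le_div_iff₀ hδ]; linarith
        have hc2 : cost f x 1 (n + 1) ≤ (μ + ε) * cost f adv 1 (n + 1) := by
          rw [cost_succ f x, cost_succ f adv, hst]
          nlinarith
        refine ⟨?_, ?_, ?_, ?_⟩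
        · rw [hst, radial_of_le le_rfl]; abel
        · rw [hst, sub_self, norm_zero, add_zero, cost_succ f x, cost_succ f adv, cost_succ f s, hst]
          nlinarith
        · rw [hst, sub_self, norm_zero, add_zero]
          exact hc2
        · have hφ : ‖x (n + 1) - s (n + 1)‖ ≤ cost f adv 1 (n + 1) + cost f s 1 (n + 1) := by
            rw [hst]
            have h := norm_sub_le_norm_sub_add_norm_sub (adv (n + 1)) x₀ (s (n + 1))
            rw [norm_sub_rev x₀] at h
            rw [hadv0] at hAn
            rw [hs0] at hSn
            linarith
          calc cost f x 1 (n + 1) + (1 + k / γ) * ‖x (n + 1) - s (n + 1)‖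
              ≤ (μ + ε) * (cost f s 1 (n + 1) / δ)
                + (1 + k / γ) * (cost f s 1 (n + 1) / δ + cost f s 1 (n + 1)) := by
                refine add_le_add (hc2.trans ?_) ?_
                · gcongr
                · gcongr; linarith
            _ = K * cost f s 1 (n + 1) := by rw [hK]; ring
      · set Δ := f (n + 1) (adv (n + 1)) + ‖adv (n + 1) - adv n‖ with hΔ
        have hG : 0 ≤ γ * Δ := by positivity
        obtain ⟨hinv, hcons, hrob⟩ :=
          interp_robust_step hμ1 hrect hlip hk1 hklip hG ihx rfl rfl hst
        have hfx : f (n + 1) (x (n + 1)) ≤ f (n + 1) (s (n + 1)) + f (n + 1) (adv (n + 1)) := by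
          rw [hinv]
          exact (hconv (n + 1) hmem).map_add_radial_le hf _ _ (norm_nonneg _)
        have hc1 : cost f x 1 (n + 1) + ‖x (n + 1) - adv (n + 1)‖
            ≤ (μ + 2 * γ) * cost f adv 1 (n + 1) + 2 * cost f s 1 (n + 1) := by
          rw [cost_succ f x, cost_succ f adv, cost_succ f s]
          nlinarith
        refine ⟨hinv, hc1, ?_, ?_⟩
        · rw [hε]; push Not at hcond; linarith
        · rw [cost_succ f x, cost_succ f s]
          suffices h : f (n + 1) (x (n + 1)) + ‖x (n + 1) - x n‖
              + (1 + k / γ) * ‖x (n + 1) - s (n + 1)‖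
              ≤ f (n + 1) (s (n + 1)) + ‖s (n + 1) - s n‖ + (1 + k / γ) * ‖x n - s n‖ by
            nlinarith
          have hφ : 0 ≤ ‖x n - s n‖ := norm_nonneg _
          rcases hrob with h | ⟨h1, h2⟩
          · rw [h, sub_self, norm_zero, mul_zero]
            have h3 := norm_sub_le_norm_sub_add_norm_sub (s (n + 1)) (s n) (x n)
            rw [norm_sub_rev (s n)] at h3
            nlinarith
          · have h3 : (1 + k / γ) * (‖x (n + 1) - s (n + 1)‖ + γ * Δ)
                ≤ (1 + k / γ) * ‖x n - s n‖ := by gcongr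
            have h4 : (1 + k / γ) * (γ * Δ) = γ * Δ + k * Δ := by field_simp
            have h5 : f (n + 1) (adv (n + 1)) ≤ k * f (n + 1) (adv (n + 1)) :=
              le_mul_of_one_le_left hfa hk1
            have h6 : k * Δ = k * f (n + 1) (adv (n + 1)) + k * ‖adv (n + 1) - adv n‖ := by
              rw [hΔ]; ring
            linarith
  have h := (key T le_rfl).2.2.2
  have : 0 ≤ (1 + k / γ) * ‖x T - s T‖ := by positivity
  linarith
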